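/- Let Γ̃ be the graph obtained from the Grassmann graph J_q(2e+1,e+1) by Godsil–McKay switching with respect to the partition {C_U ∪ C_{σ(U)} : U ∈ Gr_e(H)} ∪ {D}, i.e., for each W ∈ D and each cell C = C_U ∪ C_{σ(U)} in which W has exactly |C|/2 neighbors, adjacency and nonadjacency between W and the vertices of C are interchanged, while all other adjacencies are unchanged. Then for W_1 ∈ C_U (U ∈ Gr_e(H)) and W_2 ∈ D, W_1 and W_2 are adjacent in Γ̃ if and only if σ(U) ⊆ W_2. -/

import Mathlib

/-- `C_U = {W ∈ Gr_{e+1}(V) : W ⊄ H, W ∩ H = U}` for `U` a subspace of the hyperplane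
`H` of `V`. -/
def CSet {F V : Type*} [Field F] [AddCommGroup V] [Module F V]
    (e : ℕ) (H : Submodule F V) (U : Submodule F ↥H) : Set (Submodule F V) :=
  {W | Module.finrank F ↥W = e + 1 ∧ ¬ W ≤ H ∧ Submodule.comap H.subtype W = U}

lemma covBy_finrank_le {F M : Type*} [Field F] [AddCommGroup M] [Module F M]
    [FiniteDimensional F M] {A B : Submodule F M} (h : A ⋖ B) :
    Module.finrank F B ≤ Module.finrank F A + 1 := by
  obtain ⟨v, hvB, hvA⟩ := SetLike.exists_of_lt h.lt
  have h1 : A < A ⊔ Submodule.span F {v} := by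
    refine lt_of_le_of_ne le_sup_left ?_
    intro hh
    apply hvA
    rw [hh]
    exact Submodule.mem_sup_right (Submodule.mem_span_singleton_self v)
  have h2 : A ⊔ Submodule.span F {v} ≤ B :=
    sup_le h.le ((Submodule.span_singleton_le_iff_mem _ _).2 hvB)
  have h3 : A ⊔ Submodule.span F {v} = B := by
    by_contra hne
    exact h.2 h1 (lt_of_le_of_ne h2 hne)
  rw [← h3]
  refine (Submodule.finrank_add_le_finrank_add_finrank _ _).trans ?_
  have := finrank_span_singleton (K := F) (v := v) (fun h0 => hvA (h0 ▸ A.zero_mem))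
  omega

lemma polarity_finrank {F M : Type*} [Field F] [AddCommGroup M] [Module F M]
    [FiniteDimensional F M] (σ : Submodule F M → Submodule F M)
    (hinv : ∀ U, σ (σ U) = U) (hanti : ∀ U U' : Submodule F M, U ≤ U' → σ U' ≤ σ U)
    (U : Submodule F M) :
    Module.finrank F U + Module.finrank F (σ U) = Module.finrank F M := by
  have hs : ∀ A B : Submodule F M, A < B → σ B < σ A := by
    intro A B h
    refine lt_of_le_of_ne (hanti _ _ h.le) ?_
    intro hh
    have := congrArg σ hh
    rw [hinv, hinv] at this
    exact h.ne this.symm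
  apply le_antisymm
  · induction U using WellFoundedLT.induction with
    | ind U ih =>
      rcases eq_or_ne U ⊥ with rfl | hU
      · simpa using Submodule.finrank_le (σ ⊥)
      · obtain ⟨X, -, hX⟩ := exists_le_covBy_of_lt (bot_lt_iff_ne_bot.2 hU)
        have h1 := ih X hX.lt
        have h2 := covBy_finrank_le hX
        have h3 := Submodule.finrank_lt_finrank_of_lt (hs _ _ hX.lt)
        omega
  · induction U using WellFoundedGT.induction with
    | ind U ih =>
      rcases eq_or_ne U ⊤ with rfl | hU
      · simp
      · obtain ⟨X, hX, -⟩ := exists_covBy_le_of_lt (lt_top_iff_ne_top.2 hU)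
        have h1 := ih X hX.lt
        have h2 := covBy_finrank_le hX
        have h3 := Submodule.finrank_lt_finrank_of_lt (hs _ _ hX.lt)
        omega

lemma exists_cset_equiv {F V : Type*} [Field F] [AddCommGroup V] [Module F V]
    [FiniteDimensional F V] (H : Submodule F V) (U U' : Submodule F H)
    (h : Module.finrank F U = Module.finrank F U') :
    ∃ (k : H ≃ₗ[F] H) (g : V ≃ₗ[F] V), (∀ x : H, (k x : V) = g x) ∧
      U.map k.toLinearMap = U' := by
  let f : U ≃ₗ[F] U' := LinearEquiv.ofFinrankEq _ _ h
  obtain ⟨k, hk⟩ := Submodule.exists_linearEquiv_restrict_eq f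
  obtain ⟨g, hg⟩ := Submodule.exists_linearEquiv_restrict_eq k
  refine ⟨k, g, hg, ?_⟩
  ext x
  constructor
  · rintro ⟨y, hy, rfl⟩
    have := hk ⟨y, hy⟩
    change k y ∈ U'
    rw [← this]
    exact (f ⟨y, hy⟩).2
  · intro hx
    refine ⟨f.symm ⟨x, hx⟩, (f.symm ⟨x, hx⟩).2, ?_⟩
    change k _ = x
    rw [← hk]
    simp

lemma cset_ncard_le {F V : Type*} [Field F] [Finite F] [AddCommGroup V] [Module F V]
    [FiniteDimensional F V] (e : ℕ) (H : Submodule F V) (U U' : Submodule F H)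
    (h : Module.finrank F U = Module.finrank F U') :
    (CSet e H U).ncard ≤ (CSet e H U').ncard := by
  have : Finite V := Module.finite_of_finite F
  obtain ⟨k, g, hkg, hU⟩ := exists_cset_equiv H U U' h
  have hgH : ∀ x, x ∈ H → g x ∈ H := fun x hx => by
    rw [← hkg ⟨x, hx⟩]; exact (k _).2
  have hgH' : ∀ x, g x ∈ H → x ∈ H := fun x hx => by
    have h1 := hkg (k.symm ⟨g x, hx⟩)
    simp only [LinearEquiv.apply_symm_apply] at h1
    rw [g.injective h1]
    exact (k.symm _).2
  refine Set.ncard_le_ncard_of_injOn (fun W => W.map g.toLinearMap) ?_ ?_ (Set.toFinite _)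
  · rintro W ⟨h1, h2, h3⟩
    refine ⟨?_, ?_, ?_⟩
    · rw [← h1]
      exact LinearEquiv.finrank_map_eq g W
    · intro hle
      apply h2
      intro x hx
      exact hgH' x (hle ⟨x, hx, rfl⟩)
    · rw [← hU, ← h3]
      ext x
      constructor
      · rintro ⟨y, hy, hyx⟩
        change g y = x at hyx
        have hyH : y ∈ H := hgH' y (hyx ▸ x.2)
        refine ⟨⟨y, hyH⟩, hy, ?_⟩
        apply Subtype.ext
        rw [← hyx]
        exact hkg _
      · rintro ⟨y, hy, rfl⟩
        exact ⟨y, hy, (hkg y).symm⟩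
  · intro A _ B _ hAB
    exact Submodule.map_injective_of_injective g.injective hAB

lemma adj_iff {F V : Type*} [Field F] [AddCommGroup V] [Module F V]
    [FiniteDimensional F V] {e : ℕ} {H : Submodule F V} {U : Submodule F H}
    (hU : Module.finrank F U = e) {Z W : Submodule F V} (hZ : Z ∈ CSet e H U) (hW : W ≤ H) :
    Module.finrank F ↥(Z ⊓ W) = e ↔ U.map H.subtype ≤ W := by
  have hm : Module.finrank F (U.map H.subtype) = e := by
    rw [← hU]; exact Submodule.finrank_map_subtype_eq H U
  have hZH : Z ⊓ H = U.map H.subtype := by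
    rw [← hZ.2.2, Submodule.map_comap_subtype, inf_comm]
  have hZW : Z ⊓ W = U.map H.subtype ⊓ W := by
    rw [← hZH, inf_assoc, inf_eq_right.2 hW]
  rw [hZW]
  constructor
  · intro h
    exact inf_eq_left.1 (Submodule.eq_of_le_of_finrank_eq inf_le_left (h.trans hm.symm))
  · intro h
    rw [inf_eq_left.2 h, hm]

/-- Let `Γ̃` be the graph obtained from the Grassmann graph
`J_q(2e+1,e+1)` by Godsil–McKay switching with respect to the partition
`{C_U ∪ C_{σ(U)} : U ∈ Gr_e(H)} ∪ {D}`: for `W₂ ∈ D = Gr_{e+1}(H)` and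
`W₁ ∈ C = C_U ∪ C_{σ(U)}`, `W₁ ∼ W₂` in `Γ̃` iff either `W₂` has exactly `|C|/2`
neighbors in `C` and `W₁ ≁ W₂` in `J_q(2e+1,e+1)`, or `W₂` does not have exactly
`|C|/2` neighbors in `C` and `W₁ ∼ W₂` in `J_q(2e+1,e+1)`. Then for `W₁ ∈ C_U`
(`U ∈ Gr_e(H)`) and `W₂ ∈ D`: `W₁ ∼ W₂` in `Γ̃` if and only if `σ(U) ⊆ W₂`.
Here `n` is the number of neighbors of `W₂` in `C` and `N = |C|`. -/
theorem stmt_11 {F : Type*} [Field F] [Fintype F]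
    {V : Type*} [AddCommGroup V] [Module F V] [FiniteDimensional F V]
    (q e : ℕ) (hq : Fintype.card F = q) (he : 1 ≤ e)
    (hV : Module.finrank F V = 2 * e + 1)
    (H : Submodule F V) (hH : Module.finrank F ↥H = 2 * e)
    (σ : Submodule F ↥H → Submodule F ↥H)
    (hσinv : ∀ U, σ (σ U) = U)
    (hσanti : ∀ U U' : Submodule F ↥H, U ≤ U' → σ U' ≤ σ U)
    (U : Submodule F ↥H) (hU : Module.finrank F ↥U = e)
    (W₁ : Submodule F V) (hW₁ : W₁ ∈ CSet e H U)
    (W₂ : Submodule F V) (hW₂ : Module.finrank F ↥W₂ = e + 1) (hW₂H : W₂ ≤ H)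
    (n N : ℕ)
    (hn : {Z ∈ CSet e H U ∪ CSet e H (σ U) |
      Module.finrank F ↥(Z ⊓ W₂) = e}.ncard = n)
    (hN : (CSet e H U ∪ CSet e H (σ U)).ncard = N) :
    ((2 * n = N ∧ ¬ Module.finrank F ↥(W₁ ⊓ W₂) = e) ∨
      (2 * n ≠ N ∧ Module.finrank F ↥(W₁ ⊓ W₂) = e)) ↔
      Submodule.map H.subtype (σ U) ≤ W₂ := by
  have hfV : Finite V := Module.finite_of_finite F
  have hσU : Module.finrank F (σ U) = e := by
    have := polarity_finrank σ hσinv hσanti U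
    omega
  have hpos : 0 < (CSet e H U).ncard := (Set.ncard_pos (Set.toFinite _)).2 ⟨W₁, hW₁⟩
  have hcard : (CSet e H (σ U)).ncard = (CSet e H U).ncard :=
    le_antisymm (cset_ncard_le e H _ _ (hσU.trans hU.symm))
      (cset_ncard_le e H _ _ (hU.trans hσU.symm))
  have key : ∀ X : Submodule F H, Module.finrank F X = e →
      {Z ∈ CSet e H X | Module.finrank F ↥(Z ⊓ W₂) = e} =
        {Z ∈ CSet e H X | X.map H.subtype ≤ W₂} := by
    intro X hX
    ext Z
    exact and_congr_right fun hZ => adj_iff hX hZ hW₂H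
  rw [adj_iff hU hW₁ hW₂H]
  by_cases heq : σ U = U
  · rw [heq, Set.union_self] at hn hN
    rw [key U hU] at hn
    rw [heq]
    by_cases hle : U.map H.subtype ≤ W₂
    · simp only [hle, and_true, Set.ofPred_mem_eq] at hn ⊢
      simp
      omega
    · simp only [hle, and_false, Set.ofPred_false, Set.ncard_empty] at hn ⊢
      simp
      omega
  · have hdisj : Disjoint (CSet e H U) (CSet e H (σ U)) := by
      rw [Set.disjoint_left]
      intro Z h1 h2
      exact heq (h2.2.2.symm.trans h1.2.2)
    rw [Set.ncard_union_eq hdisj (Set.toFinite _) (Set.toFinite _)] at hN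
    have hsep : {Z ∈ CSet e H U ∪ CSet e H (σ U) | Module.finrank F ↥(Z ⊓ W₂) = e} =
        {Z ∈ CSet e H U | Module.finrank F ↥(Z ⊓ W₂) = e} ∪
        {Z ∈ CSet e H (σ U) | Module.finrank F ↥(Z ⊓ W₂) = e} := Set.sep_union
    rw [hsep, Set.ncard_union_eq (hdisj.mono (Set.sep_subset _ _) (Set.sep_subset _ _))
      (Set.toFinite _) (Set.toFinite _), key U hU, key _ hσU] at hn
    by_cases h1 : U.map H.subtype ≤ W₂ <;> by_cases h2 : (σ U).map H.subtype ≤ W₂ <;>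
      simp only [h1, h2, and_true, and_false, Set.ofPred_mem_eq, Set.ofPred_false,
        Set.ncard_empty] at hn ⊢ <;> simp <;> omega
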